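/- There exists a universal constant C > 0 with the following property: for all signs σ, σ₂, σ₃, σ₄ ∈ {−1, 1}, all dyadic numbers N₃, N₃₄, N₂₃₄, and every m ∈ ℤ, the cardinality of the set { (n₂, n₃, n₄) ∈ (ℤ²)³ : |n₃| ∼ N₃, |n₃+n₄| ∼ N₃₄, |n₂+n₃+n₄| ∼ N₂₃₄ and |ψ(n₂,n₃,n₄) − m| ≤ 1 } is at most C · (N₃ · N₃₄ · N₂₃₄)² / min(N₃₄, max(N₃, N₂₃₄))^{1/2}. -/

import Mathlib

/-- The Euclidean norm of a lattice point `x ∈ ℤ²`. -/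
noncomputable def znorm (x : Fin 2 → ℤ) : ℝ :=
  Real.sqrt ((x 0 : ℝ) ^ 2 + (x 1 : ℝ) ^ 2)

/-- The Japanese bracket `⟨x⟩ = √(1 + |x|²)` for lattice points `x ∈ ℤ²`. -/
noncomputable def jb (x : Fin 2 → ℤ) : ℝ :=
  Real.sqrt (1 + (x 0 : ℝ) ^ 2 + (x 1 : ℝ) ^ 2)

/-- `|x| ∼ N`, i.e. `N/2 ≤ |x| ≤ 2N`. -/
def ann (N : ℝ) (x : Fin 2 → ℤ) : Prop :=
  N / 2 ≤ znorm x ∧ znorm x ≤ 2 * N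

/-- The cubic phase function `φ(n₁,n₂,n₃) = σ⟨n₁+n₂+n₃⟩ + σ₁⟨n₁⟩ + σ₂⟨n₂⟩ + σ₃⟨n₃⟩`. -/
noncomputable def phase (σ σ₁ σ₂ σ₃ : ℝ) (n₁ n₂ n₃ : Fin 2 → ℤ) : ℝ :=
  σ * jb (n₁ + n₂ + n₃) + σ₁ * jb n₁ + σ₂ * jb n₂ + σ₃ * jb n₃

/-- The median (middle value) of three real numbers. -/
noncomputable def med3 (a b c : ℝ) : ℝ :=
  max (min a b) (min (max a b) c)

/-- The counting set of the cubic counting estimate (iv): variables `(n₂, n₃, n₄)` with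
constraints `|n₃| ∼ N₃`, `|n₃+n₄| ∼ N₃₄`, `|n₂+n₃+n₄| ∼ N₂₃₄` and `|ψ(n₂,n₃,n₄) − m| ≤ 1`,
where `ψ(n₂,n₃,n₄) = σ⟨n₂+n₃+n₄⟩ + σ₂⟨n₂⟩ + σ₃⟨n₃⟩ + σ₄⟨n₄⟩`. -/
def cubicSetIV (σ σ₂ σ₃ σ₄ N₃ N₃₄ N₂₃₄ : ℝ) (m : ℤ) : Set (Fin 3 → Fin 2 → ℤ) :=
  {v | ann N₃ (v 1) ∧ ann N₃₄ (v 1 + v 2) ∧ ann N₂₃₄ (v 0 + v 1 + v 2) ∧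
    |phase σ σ₂ σ₃ σ₄ (v 0) (v 1) (v 2) - (m : ℝ)| ≤ 1}

/-- A finite set is at most `K` times as large as its image if all fibres have at most `K`
elements. -/
theorem card_le_mul_card_image_real {α β : Type*} [DecidableEq β] (S : Finset α) (g : α → β)
    (K : ℝ) (hfib : ∀ z, ((S.filter (fun x => g x = z)).card : ℝ) ≤ K) :
    (S.card : ℝ) ≤ K * (S.image g).card := by
  rw [Finset.card_eq_sum_card_image g S]
  push_cast
  calc _ ≤ ∑ _z ∈ S.image g, K := Finset.sum_le_sum fun z _ => hfib z
    _ = _ := by rw [Finset.sum_const, nsmul_eq_mul, mul_comm]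

/-- Slicing a finite set along a real function of oscillation at most `L`. -/
theorem card_le_of_slices {α : Type*} (S : Finset α) (f : α → ℝ) {K L : ℝ} (hK : 0 ≤ K)
    (hL : 0 ≤ L) (hspread : ∀ x ∈ S, ∀ y ∈ S, |f x - f y| ≤ L)
    (hfib : ∀ T ⊆ S, (∀ x ∈ T, ∀ y ∈ T, |f x - f y| < 1) → (T.card : ℝ) ≤ K) :
    (S.card : ℝ) ≤ K * (L + 2) := by
  classical
  rcases S.eq_empty_or_nonempty with rfl | hS
  · simp only [Finset.card_empty, Nat.cast_zero]
    positivity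
  obtain ⟨x₀, hx₀, hmin⟩ := S.exists_min_image f hS
  have himage : S.image (fun x => ⌊f x⌋) ⊆ Finset.Icc ⌊f x₀⌋ ⌊f x₀ + L⌋ := by
    intro n hn
    obtain ⟨x, hx, rfl⟩ := Finset.mem_image.1 hn
    refine Finset.mem_Icc.2 ⟨Int.floor_le_floor (hmin x hx), Int.floor_le_floor ?_⟩
    linarith [le_abs_self (f x - f x₀), hspread x hx x₀ hx₀]
  have hcard : ((S.image (fun x => ⌊f x⌋)).card : ℝ) ≤ L + 2 := by
    have h1 : ((S.image (fun x => ⌊f x⌋)).card : ℝ) ≤ ((Finset.Icc ⌊f x₀⌋ ⌊f x₀ + L⌋).card : ℝ) := by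
      exact_mod_cast Finset.card_le_card himage
    have h2 : ((Finset.Icc ⌊f x₀⌋ ⌊f x₀ + L⌋).card : ℝ) = ⌊f x₀ + L⌋ + 1 - ⌊f x₀⌋ := by
      have h3 : ⌊f x₀⌋ ≤ ⌊f x₀ + L⌋ + 1 :=
        (Int.floor_le_floor (le_add_of_nonneg_right hL)).trans (by omega)
      have h4 := Int.card_Icc_of_le ⌊f x₀⌋ ⌊f x₀ + L⌋ h3
      exact_mod_cast h4
    linarith [Int.floor_le (f x₀ + L), Int.lt_floor_add_one (f x₀)]
  refine (card_le_mul_card_image_real S (fun x => ⌊f x⌋) K fun n => ?_).trans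
    (mul_le_mul_of_nonneg_left hcard hK)
  refine hfib _ (Finset.filter_subset _ _) fun x hx y hy => ?_
  exact Int.abs_sub_lt_one_of_floor_eq_floor
    ((Finset.mem_filter.1 hx).2.trans (Finset.mem_filter.1 hy).2.symm)

/-- A set of lattice points whose coordinates oscillate by at most `R` has at most `(R + 2)²`
elements. -/
theorem card_le_of_coord_spread (S : Finset (Fin 2 → ℤ)) {R : ℝ} (hR : 0 ≤ R)
    (h : ∀ x ∈ S, ∀ y ∈ S, ∀ i, |(x i : ℝ) - y i| ≤ R) : (S.card : ℝ) ≤ (R + 2) ^ 2 := by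
  have eq_of_lt : ∀ m n : ℤ, |(m : ℝ) - n| < 1 → m = n := by
    intro m n hmn
    have : |m - n| < 1 := by exact_mod_cast hmn
    exact sub_eq_zero.1 (Int.abs_lt_one_iff.1 this)
  have hslice : (S.card : ℝ) ≤ (1 * (R + 2)) * (R + 2) := by
    refine card_le_of_slices S (fun x => (x 0 : ℝ)) (by positivity) hR
      (fun x hx y hy => h x hx y hy 0) fun T hT hT0 => ?_
    refine card_le_of_slices T (fun x => (x 1 : ℝ)) zero_le_one hR
      (fun x hx y hy => h x (hT hx) y (hT hy) 1) fun U hU hU1 => ?_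
    have : U.card ≤ 1 := Finset.card_le_one.2 fun x hx y hy => by
      funext i
      fin_cases i
      · exact eq_of_lt _ _ (hT0 x (hU hx) y (hU hy))
      · exact eq_of_lt _ _ (hU1 x hx y hy)
    exact_mod_cast this
  linarith

theorem sq_jb (x : Fin 2 → ℤ) : jb x ^ 2 = 1 + (x 0 : ℝ) ^ 2 + (x 1 : ℝ) ^ 2 :=
  Real.sq_sqrt (by positivity)

theorem jb_nonneg (x : Fin 2 → ℤ) : 0 ≤ jb x := Real.sqrt_nonneg _

theorem sq_znorm (x : Fin 2 → ℤ) : znorm x ^ 2 = (x 0 : ℝ) ^ 2 + (x 1 : ℝ) ^ 2 :=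
  Real.sq_sqrt (by positivity)

theorem znorm_nonneg (x : Fin 2 → ℤ) : 0 ≤ znorm x := Real.sqrt_nonneg _

theorem jb_le (x : Fin 2 → ℤ) : jb x ≤ 1 + znorm x := by
  have h := znorm_nonneg x
  refine abs_le_of_sq_le_sq' ?_ (by linarith) |>.2
  nlinarith [sq_jb x, sq_znorm x]

theorem jb_sub_comm (x y : Fin 2 → ℤ) : jb (x - y) = jb (y - x) := by
  simp only [jb, Pi.sub_apply, Int.cast_sub]
  congr 1
  ring

theorem znorm_sub_le (x y : Fin 2 → ℤ) : znorm (x - y) ≤ znorm x + znorm y := by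
  have hx := znorm_nonneg x
  have hy := znorm_nonneg y
  refine abs_le_of_sq_le_sq' ?_ (by linarith) |>.2
  have hcs : -((x 0 : ℝ) * y 0 + x 1 * y 1) ≤ znorm x * znorm y := by
    refine abs_le_of_sq_le_sq' ?_ (by positivity) |>.2
    rw [mul_pow, sq_znorm, sq_znorm]
    nlinarith [sq_nonneg ((x 0 : ℝ) * y 1 - x 1 * y 0)]
  have := sq_znorm (x - y)
  simp only [Pi.sub_apply, Int.cast_sub] at this
  nlinarith [sq_znorm x, sq_znorm y]

theorem abs_coord_le_znorm (x : Fin 2 → ℤ) (i : Fin 2) : |(x i : ℝ)| ≤ znorm x := by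
  refine abs_le_of_sq_le_sq ?_ (znorm_nonneg x)
  rw [sq_znorm]
  fin_cases i
  · exact le_add_of_nonneg_right (sq_nonneg _)
  · exact le_add_of_nonneg_left (sq_nonneg _)

/-- Lattice points in a ring of width one, confined to an octant in the coordinates `p ≤ q`, are
controlled by the oscillation of the smaller coordinate `p`. -/
theorem card_le_of_octant (S : Finset (Fin 2 → ℤ)) (p q : (Fin 2 → ℤ) → ℝ) {L : ℝ} (hL : 0 ≤ L)
    (hp : ∀ x ∈ S, 0 ≤ p x) (hpq : ∀ x ∈ S, p x ≤ q x)
    (hsq : ∀ x ∈ S, p x ^ 2 + q x ^ 2 = (x 0 : ℝ) ^ 2 + (x 1 : ℝ) ^ 2)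
    (hdist : ∀ x ∈ S, ∀ y ∈ S, ((x 0 : ℝ) - y 0) ^ 2 + ((x 1 : ℝ) - y 1) ^ 2
      ≤ (p x - p y) ^ 2 + (q x - q y) ^ 2)
    (hring : ∀ x ∈ S, ∀ y ∈ S, |jb x - jb y| < 1)
    (hspread : ∀ x ∈ S, ∀ y ∈ S, |p x - p y| ≤ L) : (S.card : ℝ) ≤ 64 * (L + 2) := by
  refine card_le_of_slices S p (by norm_num) hL hspread fun T hT hTp => ?_
  have jb_le_q : ∀ x ∈ S, jb x ≤ 1 + 2 * q x := by
    intro x hx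
    have := hp x hx
    have := hpq x hx
    refine abs_le_of_sq_le_sq' ?_ (by linarith) |>.2
    nlinarith [sq_jb x, hsq x hx]
  have hq : ∀ x ∈ T, ∀ y ∈ T, q x - q y ≤ 5 := by
    intro x hx y hy
    by_contra! hlt
    have hx' := hT hx
    have hy' := hT hy
    have h1 : q x ^ 2 - q y ^ 2
        = (jb x - jb y) * (jb x + jb y) - (p x - p y) * (p x + p y) := by
      linarith [hsq x hx', hsq y hy', sq_jb x, sq_jb y]
    have h2 : (jb x - jb y) * (jb x + jb y) ≤ 1 * (jb x + jb y) :=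
      mul_le_mul_of_nonneg_right (abs_lt.1 (hring x hx' y hy')).2.le
        (add_nonneg (jb_nonneg x) (jb_nonneg y))
    have h3 : -1 * (p x + p y) ≤ (p x - p y) * (p x + p y) :=
      mul_le_mul_of_nonneg_right (abs_lt.1 (hTp x hx y hy)).1.le
        (add_nonneg (hp x hx') (hp y hy'))
    nlinarith [jb_le_q x hx', jb_le_q y hy', hpq x hx', hpq y hy', hp x hx', hp y hy']
  have hbound : (T.card : ℝ) ≤ (6 + 2) ^ 2 := by
    refine card_le_of_coord_spread T (by norm_num) fun x hx y hy i => ?_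
    have h1 := hdist x (hT hx) y (hT hy)
    have h2 : (p x - p y) ^ 2 ≤ 1 := by
      rw [← sq_abs]
      nlinarith [hTp x hx y hy, abs_nonneg (p x - p y)]
    have h3 : (q x - q y) ^ 2 ≤ 25 := by
      nlinarith [hq x hx y hy, hq y hy x hx]
    refine abs_le_of_sq_le_sq ?_ (by norm_num)
    fin_cases i
    · change ((x 0 : ℝ) - y 0) ^ 2 ≤ _
      nlinarith [sq_nonneg ((x 1 : ℝ) - y 1)]
    · change ((x 1 : ℝ) - y 1) ^ 2 ≤ _
      nlinarith [sq_nonneg ((x 0 : ℝ) - y 0)]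
  linarith

/-- Lattice points in a ring of width one are controlled by the oscillation of the absolute values
of two orthonormal coordinates `u, v`. -/
theorem card_le_of_ring (S : Finset (Fin 2 → ℤ)) (u v : (Fin 2 → ℤ) → ℝ) {L : ℝ} (hL : 0 ≤ L)
    (hsq : ∀ x, u x ^ 2 + v x ^ 2 = (x 0 : ℝ) ^ 2 + (x 1 : ℝ) ^ 2)
    (hdist : ∀ x y, (u x - u y) ^ 2 + (v x - v y) ^ 2
      = ((x 0 : ℝ) - y 0) ^ 2 + ((x 1 : ℝ) - y 1) ^ 2)
    (hring : ∀ x ∈ S, ∀ y ∈ S, |jb x - jb y| < 1)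
    (hu : ∀ x ∈ S, ∀ y ∈ S, |(|u x| - |u y|)| ≤ L)
    (hv : ∀ x ∈ S, ∀ y ∈ S, |(|v x| - |v y|)| ≤ L) : (S.card : ℝ) ≤ 512 * (L + 2) := by
  classical
  let g : (Fin 2 → ℤ) → Bool × Bool × Bool :=
    fun x => (decide (0 ≤ u x), decide (0 ≤ v x), decide (|u x| ≤ |v x|))
  have himage : ((S.image g).card : ℝ) ≤ 8 := by
    exact_mod_cast (Finset.card_le_univ (S.image g)).trans_eq (by rfl)
  have sq_abs_sub : ∀ a b : ℝ, (0 ≤ a ↔ 0 ≤ b) → (|a| - |b|) ^ 2 = (a - b) ^ 2 := by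
    intro a b hab
    by_cases ha : 0 ≤ a
    · rw [abs_of_nonneg ha, abs_of_nonneg (hab.1 ha)]
    · have hb : ¬ 0 ≤ b := fun h => ha (hab.2 h)
      rw [abs_of_neg (not_le.1 ha), abs_of_neg (not_le.1 hb)]
      ring
  have hfib : ∀ z, ((S.filter (fun x => g x = z)).card : ℝ) ≤ 64 * (L + 2) := by
    intro z
    have hS : ∀ x ∈ S.filter (fun x => g x = z), x ∈ S := fun x hx => (Finset.mem_filter.1 hx).1
    have hg : ∀ x ∈ S.filter (fun x => g x = z), g x = z := fun x hx => (Finset.mem_filter.1 hx).2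
    have hd : ∀ x ∈ S.filter (fun x => g x = z), ∀ y ∈ S.filter (fun x => g x = z),
        ((x 0 : ℝ) - y 0) ^ 2 + ((x 1 : ℝ) - y 1) ^ 2
          = (|u x| - |u y|) ^ 2 + (|v x| - |v y|) ^ 2 := by
      intro x hx y hy
      have h := (hg x hx).trans (hg y hy).symm
      simp only [g, Prod.mk.injEq, decide_eq_decide] at h
      rw [sq_abs_sub _ _ h.1, sq_abs_sub _ _ h.2.1, hdist]
    rcases hz : z.2.2 with _ | _
    · refine card_le_of_octant _ (fun x => |v x|) (fun x => |u x|) hL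
        (fun x _ => abs_nonneg _) (fun x hx => ?_) (fun x _ => ?_)
        (fun x hx y hy => ?_) (fun x hx y hy => hring x (hS x hx) y (hS y hy))
        (fun x hx y hy => hv x (hS x hx) y (hS y hy))
      · have h := hg x hx
        rw [← h] at hz
        simp only [g, decide_eq_false_iff_not, not_le] at hz
        exact hz.le
      · simp only [sq_abs]
        linarith [hsq x]
      · linarith [hd x hx y hy]
    · refine card_le_of_octant _ (fun x => |u x|) (fun x => |v x|) hL
        (fun x _ => abs_nonneg _) (fun x hx => ?_) (fun x _ => ?_)
        (fun x hx y hy => ?_) (fun x hx y hy => hring x (hS x hx) y (hS y hy))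
        (fun x hx y hy => hu x (hS x hx) y (hS y hy))
      · have h := hg x hx
        rw [← h] at hz
        simpa only [g, decide_eq_true_eq] using hz
      · simp only [sq_abs]
        exact hsq x
      · exact (hd x hx y hy).le
  have hmul := mul_le_mul_of_nonneg_left himage (show 0 ≤ 64 * (L + 2) by positivity)
  linarith [card_le_mul_card_image_real S g _ hfib]

/-- Two-ball counting: the lattice points `a` with `|a| ≤ 2A` in a unit neighbourhood of a conic
with foci `0` and `b`. -/
theorem card_conic_le (S : Finset (Fin 2 → ℤ)) (b : Fin 2 → ℤ) {A M σ τ t : ℝ}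
    (hσ : σ = -1 ∨ σ = 1) (hτ : τ = -1 ∨ τ = 1) (hM : 1 ≤ M) (hMA : M ≤ A)
    (hMb : M / 2 ≤ znorm b) (hA : ∀ a ∈ S, znorm a ≤ 2 * A)
    (ht : ∀ a ∈ S, |σ * jb a + τ * jb (b - a) - t| ≤ 1) :
    (S.card : ℝ) ≤ 75000 * (A ^ 2 / Real.sqrt M) := by
  set β := znorm b
  have hβ0 : 0 < β := by linarith
  have hA1 : 1 ≤ A := hM.trans hMA
  have hM0 : 0 < M := by linarith
  have hw : 0 < Real.sqrt M := Real.sqrt_pos.2 hM0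
  have hw1 : 1 ≤ Real.sqrt M := Real.one_le_sqrt.2 hM
  have hww : Real.sqrt M ^ 2 = M := Real.sq_sqrt hM0.le
  have hwA : Real.sqrt M ≤ A := by nlinarith
  have hβsq : β ^ 2 = (b 0 : ℝ) ^ 2 + (b 1 : ℝ) ^ 2 := sq_znorm b
  have hAM : 1 ≤ A / M := (one_le_div hM0).2 hMA
  have hAw : 1 ≤ A / Real.sqrt M := (one_le_div hw).2 hwA
  have hAMw : A / M ≤ A / Real.sqrt M := by
    refine div_le_div_of_nonneg_left (by linarith) hw ?_
    nlinarith
  let u : (Fin 2 → ℤ) → ℝ := fun x => ((x 0 : ℝ) * b 0 + x 1 * b 1) / β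
  let v : (Fin 2 → ℤ) → ℝ := fun x => ((x 0 : ℝ) * b 1 - x 1 * b 0) / β
  have hsq : ∀ x, u x ^ 2 + v x ^ 2 = (x 0 : ℝ) ^ 2 + (x 1 : ℝ) ^ 2 := by
    intro x
    simp only [u, v]
    rw [div_pow, div_pow, ← add_div, div_eq_iff (by positivity), hβsq]
    ring
  have hdist : ∀ x y, (u x - u y) ^ 2 + (v x - v y) ^ 2
      = ((x 0 : ℝ) - y 0) ^ 2 + ((x 1 : ℝ) - y 1) ^ 2 := by
    intro x y
    simp only [u, v]
    rw [← sub_div, ← sub_div, div_pow, div_pow, ← add_div, div_eq_iff (by positivity), hβsq]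
    ring
  have hfocal : ∀ x, 2 * β * u x = jb x ^ 2 - jb (b - x) ^ 2 + β ^ 2 := by
    intro x
    have h1 : β * u x = (x 0 : ℝ) * b 0 + x 1 * b 1 := mul_div_cancel₀ _ hβ0.ne'
    rw [mul_assoc, h1, sq_jb, sq_jb, hβsq]
    simp only [Pi.sub_apply, Int.cast_sub]
    ring
  have hr : ∀ x ∈ S, jb x ≤ 1 + 2 * A := fun x hx => by linarith [jb_le x, hA x hx]
  have hs : ∀ x ∈ S, jb (b - x) ≤ 1 + 2 * A + β := fun x hx => by
    linarith [jb_le (b - x), hA x hx, znorm_sub_le b x]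
  have hslice : (S.card : ℝ) ≤ 512 * (27 * (A / Real.sqrt M) + 2) * (1 + 2 * A + 2) := by
    refine card_le_of_slices S jb (by positivity) (by positivity) (fun x hx y hy => ?_)
      fun T hT hring => ?_
    · rw [abs_le]
      constructor <;> linarith [hr x hx, hr y hy, jb_nonneg x, jb_nonneg y]
    have hu : ∀ x ∈ T, ∀ y ∈ T, u x - u y ≤ 27 * (A / M) := by
      intro x hx y hy
      have hx' := hT hx
      have hy' := hT hy
      have hr1 := abs_lt.1 (hring x hx y hy)
      have hs1 : jb (b - y) - jb (b - x) ≤ 3 := by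
        have h1 := abs_le.1 (ht x hx')
        have h2 := abs_le.1 (ht y hy')
        rcases hσ with rfl | rfl <;> rcases hτ with rfl | rfl <;> linarith
      have h1 : (jb x - jb y) * (jb x + jb y) ≤ 1 * (jb x + jb y) :=
        mul_le_mul_of_nonneg_right hr1.2.le (add_nonneg (jb_nonneg x) (jb_nonneg y))
      have h2 : (jb (b - y) - jb (b - x)) * (jb (b - y) + jb (b - x))
          ≤ 3 * (jb (b - y) + jb (b - x)) :=
        mul_le_mul_of_nonneg_right hs1 (add_nonneg (jb_nonneg _) (jb_nonneg _))
      have h3 : 2 * β * (u x - u y) ≤ 24 * A + 6 * β := by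
        nlinarith [hfocal x, hfocal y, hr x hx', hr y hy', hs x hx', hs y hy']
      have h4 : A ≤ 2 * β * (A / M) := by
        rw [mul_div_assoc', le_div_iff₀ hM0]
        nlinarith
      have h5 : β ≤ β * (A / M) := le_mul_of_one_le_right hβ0.le hAM
      by_contra! hlt
      have h6 : 2 * β * (27 * (A / M)) < 2 * β * (u x - u y) :=
        mul_lt_mul_of_pos_left hlt (by positivity)
      linarith
    have hu' : ∀ x ∈ T, ∀ y ∈ T, |(|u x| - |u y|)| ≤ 27 * (A / M) := fun x hx y hy =>
      (abs_abs_sub_abs_le_abs_sub _ _).trans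
        (abs_le.2 ⟨by linarith [hu y hy x hx], hu x hx y hy⟩)
    have huA : ∀ x ∈ T, |u x| ≤ 2 * A := by
      intro x hx
      refine abs_le_of_sq_le_sq ?_ (by linarith)
      nlinarith [hsq x, sq_znorm x, hA x (hT hx), znorm_nonneg x, sq_nonneg (v x)]
    have hv : ∀ x ∈ T, ∀ y ∈ T, |v x| - |v y| ≤ 27 * (A / Real.sqrt M) := by
      intro x hx y hy
      have hx' := hT hx
      have hy' := hT hy
      have h1 : (jb x - jb y) * (jb x + jb y) ≤ 1 * (jb x + jb y) :=
        mul_le_mul_of_nonneg_right (abs_lt.1 (hring x hx y hy)).2.le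
          (add_nonneg (jb_nonneg x) (jb_nonneg y))
      have h2 : (|u y| - |u x|) * (|u y| + |u x|) ≤ 27 * (A / M) * (|u y| + |u x|) :=
        mul_le_mul_of_nonneg_right (abs_le.1 (hu' y hy x hx)).2 (by positivity)
      have h3 : 27 * (A / M) * (|u y| + |u x|) ≤ 27 * (A / M) * (4 * A) :=
        mul_le_mul_of_nonneg_left (by linarith [huA x hx, huA y hy]) (by positivity)
      have h4 : (A / Real.sqrt M) ^ 2 = A / M * A := by
        rw [div_pow, hww]
        ring
      have h5 : A ≤ A / M * A := le_mul_of_one_le_left (by linarith) hAM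
      have h6 : |v x| ^ 2 - |v y| ^ 2 ≤ 114 * (A / Real.sqrt M) ^ 2 := by
        have e1 := hsq x
        have e2 := hsq y
        rw [← sq_abs (u x), ← sq_abs (v x)] at e1
        rw [← sq_abs (u y), ← sq_abs (v y)] at e2
        nlinarith [sq_jb x, sq_jb y, hr x hx', hr y hy']
      by_contra! hlt
      nlinarith [abs_nonneg (v x), abs_nonneg (v y)]
    refine card_le_of_ring T u v (by positivity) hsq hdist hring (fun x hx y hy => ?_)
      (fun x hx y hy => abs_le.2 ⟨by linarith [hv y hy x hx], hv x hx y hy⟩)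
    linarith [hu' x hx y hy]
  have hfinal : A ^ 2 / Real.sqrt M = A / Real.sqrt M * A := by ring
  rw [hfinal]
  have hmul : (27 * (A / Real.sqrt M) + 2) * (1 + 2 * A + 2) ≤ 29 * (A / Real.sqrt M) * (5 * A) :=
    mul_le_mul (by linarith) (by linarith) (by positivity) (by positivity)
  have hpos : 0 ≤ A / Real.sqrt M * A := by positivity
  linarith

/-- Summing the two-ball count over the midpoint `b` and an extra variable `c`, after a change of
variables `(a, b, c)`. -/
theorem card_le_of_conic_fibres (S : Finset (Fin 3 → Fin 2 → ℤ))
    (a b c : (Fin 3 → Fin 2 → ℤ) → Fin 2 → ℤ)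
    (hinj : ∀ x y, a x = a y → b x = b y → c x = c y → x = y)
    {A B D σ τ : ℝ} (t : (Fin 2 → ℤ) → (Fin 2 → ℤ) → ℝ)
    (hσ : σ = -1 ∨ σ = 1) (hτ : τ = -1 ∨ τ = 1) (hA : 1 ≤ A) (hB : 1 ≤ B) (hD : 1 ≤ D)
    (ha : ∀ x ∈ S, ann A (a x)) (hb : ∀ x ∈ S, ann B (b x)) (hc : ∀ x ∈ S, ann D (c x))
    (ht : ∀ x ∈ S, |σ * jb (a x) + τ * jb (b x - a x) - t (b x) (c x)| ≤ 1) :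
    (S.card : ℝ) ≤ 100000000 * (A * B * D) ^ 2 / Real.sqrt (min B A) := by
  classical
  have hbox : ∀ (f : (Fin 3 → Fin 2 → ℤ) → Fin 2 → ℤ) {N : ℝ}, 1 ≤ N → (∀ x ∈ S, ann N (f x)) →
      ((S.image f).card : ℝ) ≤ 36 * N ^ 2 := by
    intro f N hN hf
    have : ((S.image f).card : ℝ) ≤ (4 * N + 2) ^ 2 := by
      refine card_le_of_coord_spread _ (by positivity) fun y hy z hz i => ?_
      obtain ⟨y', hy', rfl⟩ := Finset.mem_image.1 hy
      obtain ⟨z', hz', rfl⟩ := Finset.mem_image.1 hz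
      have h1 := abs_le.1 ((abs_coord_le_znorm (f y') i).trans (hf y' hy').2)
      have h2 := abs_le.1 ((abs_coord_le_znorm (f z') i).trans (hf z' hz').2)
      rw [abs_le]
      constructor <;> linarith
    nlinarith
  have hfib : ∀ z : (Fin 2 → ℤ) × (Fin 2 → ℤ),
      ((S.filter (fun x => (b x, c x) = z)).card : ℝ)
        ≤ 75000 * (A ^ 2 / Real.sqrt (min B A)) := by
    intro z
    set T := S.filter (fun x => (b x, c x) = z)
    have hTS : ∀ x ∈ T, x ∈ S := fun x hx => (Finset.mem_filter.1 hx).1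
    have hTb : ∀ x ∈ T, b x = z.1 := fun x hx => by rw [← (Finset.mem_filter.1 hx).2]
    have hTc : ∀ x ∈ T, c x = z.2 := fun x hx => by rw [← (Finset.mem_filter.1 hx).2]
    have hcard : T.card = (T.image a).card := by
      refine (Finset.card_image_of_injOn fun x hx y hy hxy => ?_).symm
      exact hinj x y hxy ((hTb x hx).trans (hTb y hy).symm) ((hTc x hx).trans (hTc y hy).symm)
    rcases T.eq_empty_or_nonempty with hem | ⟨x₀, hx₀⟩
    · rw [hem]
      simp only [Finset.card_empty, Nat.cast_zero]
      positivity
    rw [hcard]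
    refine card_conic_le (T.image a) z.1 (t := t z.1 z.2) hσ hτ (le_min hB hA)
      (min_le_right _ _) ?_ ?_ ?_
    · have := (hb x₀ (hTS x₀ hx₀)).1
      rw [hTb x₀ hx₀] at this
      linarith [min_le_left B A]
    · intro y hy
      obtain ⟨x, hx, rfl⟩ := Finset.mem_image.1 hy
      exact (ha x (hTS x hx)).2
    · intro y hy
      obtain ⟨x, hx, rfl⟩ := Finset.mem_image.1 hy
      have := ht x (hTS x hx)
      rwa [hTb x hx, hTc x hx] at this
  have himage : ((S.image (fun x => (b x, c x))).card : ℝ) ≤ 36 * B ^ 2 * (36 * D ^ 2) := by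
    have hsub : S.image (fun x => (b x, c x)) ⊆ S.image b ×ˢ S.image c := by
      intro z hz
      obtain ⟨x, hx, rfl⟩ := Finset.mem_image.1 hz
      exact Finset.mem_product.2 ⟨Finset.mem_image_of_mem b hx, Finset.mem_image_of_mem c hx⟩
    have h1 : ((S.image (fun x => (b x, c x))).card : ℝ)
        ≤ ((S.image b).card : ℝ) * (S.image c).card := by
      exact_mod_cast (Finset.card_le_card hsub).trans_eq (Finset.card_product _ _)
    exact h1.trans (mul_le_mul (hbox b hB hb) (hbox c hD hc) (by positivity) (by positivity))
  calc (S.card : ℝ)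
      ≤ 75000 * (A ^ 2 / Real.sqrt (min B A)) * (S.image (fun x => (b x, c x))).card :=
        card_le_mul_card_image_real S _ _ hfib
    _ ≤ 75000 * (A ^ 2 / Real.sqrt (min B A)) * (36 * B ^ 2 * (36 * D ^ 2)) :=
        mul_le_mul_of_nonneg_left himage (by positivity)
    _ = 97200000 * ((A * B * D) ^ 2 / Real.sqrt (min B A)) := by ring
    _ ≤ 100000000 * ((A * B * D) ^ 2 / Real.sqrt (min B A)) :=
        mul_le_mul_of_nonneg_right (by norm_num) (by positivity)
    _ = _ := by ring

theorem finite_setOf_znorm_le (R : ℝ) : {x : Fin 2 → ℤ | znorm x ≤ R}.Finite := by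
  refine (Set.finite_Icc (fun _ : Fin 2 => -⌈R⌉) (fun _ => ⌈R⌉)).subset fun x hx => ?_
  have h : ∀ i, |x i| ≤ ⌈R⌉ := fun i => by
    have := (abs_coord_le_znorm x i).trans (hx.trans (Int.le_ceil R))
    exact_mod_cast this
  exact ⟨fun i => (abs_le.1 (h i)).1, fun i => (abs_le.1 (h i)).2⟩

/-- The partial sums `n₃`, `n₃ + n₄`, `n₂ + n₃ + n₄` determine `(n₂, n₃, n₄)`. -/
theorem eq_of_partial_sums_eq (x y : Fin 3 → Fin 2 → ℤ) (h1 : x 1 = y 1)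
    (h2 : x 1 + x 2 = y 1 + y 2) (h3 : x 0 + x 1 + x 2 = y 0 + y 1 + y 2) : x = y := by
  have e2 : x 2 = y 2 := by rwa [h1, add_left_cancel_iff] at h2
  have e0 : x 0 = y 0 := by rwa [h1, e2, add_left_inj, add_left_inj] at h3
  funext i
  fin_cases i
  · exact e0
  · exact h1
  · exact e2

theorem finite_cubicSetIV (σ σ₂ σ₃ σ₄ N₃ N₃₄ N₂₃₄ : ℝ) (m : ℤ) :
    (cubicSetIV σ σ₂ σ₃ σ₄ N₃ N₃₄ N₂₃₄ m).Finite := by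
  refine Set.Finite.of_injOn (f := fun x => (x 1, x 1 + x 2, x 0 + x 1 + x 2))
    (t := {x | znorm x ≤ 2 * N₃} ×ˢ {x | znorm x ≤ 2 * N₃₄} ×ˢ {x | znorm x ≤ 2 * N₂₃₄})
    (fun x hx => ⟨hx.1.2, hx.2.1.2, hx.2.2.1.2⟩) (fun x _ y _ hxy => ?_)
    ((finite_setOf_znorm_le _).prod ((finite_setOf_znorm_le _).prod (finite_setOf_znorm_le _)))
  simp only [Prod.mk.injEq] at hxy
  exact eq_of_partial_sums_eq x y hxy.1 hxy.2.1 hxy.2.2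

/-- cubic counting estimate (iv): there is a universal `C > 0` such that for all
signs, dyadic `N₃, N₃₄, N₂₃₄` and every `m ∈ ℤ`, the cardinality of the above set is
`≤ C (N₃N₃₄N₂₃₄)² / min(N₃₄, max(N₃,N₂₃₄))^{1/2}`. -/
theorem cubic_counting_iv :
    ∃ C : ℝ, 0 < C ∧
      ∀ (σ σ₂ σ₃ σ₄ : ℝ), (σ = -1 ∨ σ = 1) → (σ₂ = -1 ∨ σ₂ = 1) →
        (σ₃ = -1 ∨ σ₃ = 1) → (σ₄ = -1 ∨ σ₄ = 1) →
        ∀ (k₃ k₃₄ k₂₃₄ : ℕ) (m : ℤ),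
          (cubicSetIV σ σ₂ σ₃ σ₄ ((2:ℝ)^k₃) ((2:ℝ)^k₃₄) ((2:ℝ)^k₂₃₄) m).Finite ∧
          ((cubicSetIV σ σ₂ σ₃ σ₄ ((2:ℝ)^k₃) ((2:ℝ)^k₃₄) ((2:ℝ)^k₂₃₄) m).ncard : ℝ) ≤
            C * ((2:ℝ)^k₃ * (2:ℝ)^k₃₄ * (2:ℝ)^k₂₃₄) ^ 2 /
              Real.sqrt (min ((2:ℝ)^k₃₄) (max ((2:ℝ)^k₃) ((2:ℝ)^k₂₃₄))) := by
  refine ⟨100000000, by norm_num, ?_⟩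
  intro σ σ₂ σ₃ σ₄ hσ hσ₂ hσ₃ hσ₄ k₃ k₃₄ k₂₃₄ m
  have hfin := finite_cubicSetIV σ σ₂ σ₃ σ₄ ((2:ℝ)^k₃) ((2:ℝ)^k₃₄) ((2:ℝ)^k₂₃₄) m
  refine ⟨hfin, ?_⟩
  have h₃ : (1:ℝ) ≤ 2 ^ k₃ := one_le_pow₀ one_le_two
  have h₃₄ : (1:ℝ) ≤ 2 ^ k₃₄ := one_le_pow₀ one_le_two
  have h₂₃₄ : (1:ℝ) ≤ 2 ^ k₂₃₄ := one_le_pow₀ one_le_two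
  rw [Set.ncard_eq_toFinset_card _ hfin]
  have hmem := fun x (hx : x ∈ hfin.toFinset) => hfin.mem_toFinset.1 hx
  have hphase : ∀ x ∈ hfin.toFinset,
      |σ₃ * jb (x 1) + σ₄ * jb (x 1 + x 2 - x 1) + (σ * jb (x 0 + x 1 + x 2)
        + σ₂ * jb (x 1 + x 2 - (x 0 + x 1 + x 2))) - m| ≤ 1 := by
    intro x hx
    rw [jb_sub_comm (x 1 + x 2) (x 0 + x 1 + x 2),
      show x 0 + x 1 + x 2 - (x 1 + x 2) = x 0 by abel, add_sub_cancel_left]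
    refine le_of_eq_of_le (congrArg abs ?_) (hmem x hx).2.2.2
    rw [phase]
    ring
  rcases le_total ((2:ℝ)^k₂₃₄) ((2:ℝ)^k₃) with hle | hle
  · rw [max_eq_left hle]
    refine card_le_of_conic_fibres hfin.toFinset (fun x => x 1) (fun x => x 1 + x 2)
      (fun x => x 0 + x 1 + x 2) eq_of_partial_sums_eq
      (fun b c => m - (σ * jb c + σ₂ * jb (b - c))) hσ₃ hσ₄ h₃ h₃₄ h₂₃₄
      (fun x hx => (hmem x hx).1) (fun x hx => (hmem x hx).2.1) (fun x hx => (hmem x hx).2.2.1)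
      fun x hx => le_of_eq_of_le (congrArg abs ?_) (hphase x hx)
    ring
  · rw [max_eq_right hle, show (2:ℝ)^k₃ * 2^k₃₄ * 2^k₂₃₄ = 2^k₂₃₄ * 2^k₃₄ * 2^k₃ by ring]
    refine card_le_of_conic_fibres hfin.toFinset (fun x => x 0 + x 1 + x 2)
      (fun x => x 1 + x 2) (fun x => x 1)
      (fun x y h3 h2 h1 => eq_of_partial_sums_eq x y h1 h2 h3)
      (fun b a => m - (σ₃ * jb a + σ₄ * jb (b - a))) hσ hσ₂ h₂₃₄ h₃₄ h₃
      (fun x hx => (hmem x hx).2.2.1) (fun x hx => (hmem x hx).2.1) (fun x hx => (hmem x hx).1)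
      fun x hx => le_of_eq_of_le (congrArg abs ?_) (hphase x hx)
    ring
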